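/- arXiv:2008.08368 — 4 statements merged into one kernel-verified Lean document; each statement's English description precedes it below -/
import Mathlib

section
/- Let (V,E) be a finite DAG, let k, c, d be natural numbers with c ≤ k, d = k − c and k > 3d, and let (s_i, t_i) for i ∈ {1,…,k} be terminal pairs of vertices. Then there exists a family of paths P_1,…,P_k such that each P_i is a shortest path from s_i to t_i and every vertex has congestion at most c with respect to (P_1,…,P_k), if and only if both of the following hold: (a) for every i ∈ {1,…,k} there is a walk from s_i to t_i; and (b) there exists a subset C ⊆ {1,…,k} with |C| = 3d together with a family of paths (Q_i)_{i∈C} such that each Q_i is a shortest path from s_i to t_i and every vertex has congestion at most 2d with respect to (Q_i)_{i∈C}. -/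
/-- A walk from `s` to `t` in the digraph `(V, E)`: a nonempty list of vertices starting
at `s`, ending at `t`, with `E` holding between consecutive vertices. -/
def IsWalk {V : Type*} (E : V → V → Prop) (s t : V) (W : List V) : Prop :=
  W ≠ [] ∧ W.head? = some s ∧ W.getLast? = some t ∧ W.Chain' E

/-- The length of a walk: the number of consecutive pairs (edges). -/
def walkLength {V : Type*} (W : List V) : ℕ := W.length - 1

/-- A path: a walk with pairwise distinct vertices. -/
def IsPath {V : Type*} (E : V → V → Prop) (s t : V) (W : List V) : Prop :=
  IsWalk E s t W ∧ W.Nodup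

/-- Acyclicity: no walk of positive length starts and ends at the same vertex. -/
def IsAcyclic {V : Type*} (E : V → V → Prop) : Prop :=
  ∀ (v : V) (W : List V), IsWalk E v v W → walkLength W = 0

/-- The distance from `s` to `t`: the minimum length of a walk from `s` to `t`. -/
noncomputable def walkDist {V : Type*} (E : V → V → Prop) (s t : V) : ℕ :=
  sInf {n | ∃ W, IsWalk E s t W ∧ walkLength W = n}

/-- A shortest path from `s` to `t`: a path from `s` to `t` of length `walkDist E s t`. -/
def IsShortestPath {V : Type*} (E : V → V → Prop) (s t : V) (W : List V) : Prop :=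
  IsPath E s t W ∧ walkLength W = walkDist E s t

/-- The congestion of a vertex `v` with respect to a family of walks:
the number of members of the family containing `v`. -/
noncomputable def congestion {V : Type*} {ι : Type*} (P : ι → List V) (v : V) : ℕ :=
  Nat.card {i : ι // v ∈ P i}

open Finset in
/-- Among more than `3 * d` sets, three points each avoided by at most `d` of them lie in a
common one. -/
lemma exists_mem_three {V ι : Type*} [DecidableEq V] (P : ι → List V) (C : Finset ι) (d : ℕ)
    (hC : 3 * d < #C) {u v w : V} (hu : #C ≤ #{i ∈ C | u ∈ P i} + d)
    (hv : #C ≤ #{i ∈ C | v ∈ P i} + d) (hw : #C ≤ #{i ∈ C | w ∈ P i} + d) :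
    ∃ j ∈ C, u ∈ P j ∧ v ∈ P j ∧ w ∈ P j := by
  classical
  by_contra! h
  have hsub : C ⊆ {i ∈ C | u ∉ P i} ∪ {i ∈ C | v ∉ P i} ∪ {i ∈ C | w ∉ P i} := by
    intro i hi
    have := h i hi
    simp only [mem_union, mem_filter]
    tauto
  have h1 := card_le_card hsub
  have h2 := card_union_le ({i ∈ C | u ∉ P i} ∪ {i ∈ C | v ∉ P i}) {i ∈ C | w ∉ P i}
  have h3 := card_union_le {i ∈ C | u ∉ P i} {i ∈ C | v ∉ P i}
  have h4 := card_filter_add_card_filter_not (s := C) (fun i => u ∈ P i)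
  have h5 := card_filter_add_card_filter_not (s := C) (fun i => v ∈ P i)
  have h6 := card_filter_add_card_filter_not (s := C) (fun i => w ∈ P i)
  omega

section Splice

variable {V : Type*} [LinearOrder V] {E : V → V → Prop}

lemma IsWalk.pairwise (hE : ∀ a b, E a b → a < b) {s t : V} {W : List V} (h : IsWalk E s t W) :
    W.Pairwise (· < ·) :=
  List.isChain_iff_pairwise.1 (h.2.2.2.imp hE)

/-- The part of `P` before `u`, followed by the part of `Q` from `u` on. -/
def splice (P Q : List V) (u : V) : List V :=
  P.filter (· < u) ++ Q.filter (u ≤ ·)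

lemma mem_splice {P Q : List V} {u x : V} :
    x ∈ splice P Q u ↔ if x < u then x ∈ P else x ∈ Q := by
  split_ifs with h
  · simp [splice, h]
  · simp [splice, h, not_lt.1 h]

lemma length_splice_add (P Q : List V) (u : V) :
    (splice P Q u).length + (splice Q P u).length = P.length + Q.length := by
  have key (L : List V) :
      L.length = (L.filter (· < u)).length + (L.filter (u ≤ ·)).length := by
    have := List.length_eq_length_filter_add (l := L) (fun x => decide (x < u))
    simpa [← not_lt] using this
  have h1 := key P
  have h2 := key Q
  simp only [splice, List.length_append]
  omega

lemma IsWalk.splice (hE : ∀ a b, E a b → a < b) {s t s' t' u : V} {P Q : List V}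
    (hP : IsWalk E s t P) (hQ : IsWalk E s' t' Q) (huP : u ∈ P) (huQ : u ∈ Q) :
    IsWalk E s t' (splice P Q u) := by
  have sP := hP.pairwise hE
  have sQ := hQ.pairwise hE
  obtain ⟨A, B, rfl⟩ := List.append_of_mem huP
  obtain ⟨A', B', rfl⟩ := List.append_of_mem huQ
  rw [List.pairwise_append, List.pairwise_cons] at sP sQ
  have e : _root_.splice (A ++ u :: B) (A' ++ u :: B') u = A ++ u :: B' := by
    have h1 : A.filter (· < u) = A := List.filter_eq_self.2 fun a ha => by
      simpa using sP.2.2 a ha u (by simp)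
    have h2 : B.filter (· < u) = [] := List.filter_eq_nil_iff.2 fun a ha => by
      simpa using (sP.2.1.1 a ha).le
    have h3 : A'.filter (u ≤ ·) = [] := List.filter_eq_nil_iff.2 fun a ha => by
      simpa using sQ.2.2 a ha u (by simp)
    have h4 : B'.filter (u ≤ ·) = B' := List.filter_eq_self.2 fun a ha => by
      simpa using (sQ.2.1.1 a ha).le
    simp [_root_.splice, h1, h2, h3, h4]
  rw [e]
  obtain ⟨-, hs, -, cP⟩ := hP
  obtain ⟨-, -, ht, cQ⟩ := hQ
  refine ⟨by simp, ?_, ?_, ?_⟩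
  · cases A <;> simpa using hs
  · simpa [List.getLast?_append] using ht
  · exact List.isChain_split.2 ⟨(List.isChain_split.1 cP).1, (List.isChain_split.1 cQ).2⟩

end Splice

lemma walkDist_le {V : Type*} {E : V → V → Prop} {s t : V} {W : List V} (h : IsWalk E s t W) :
    walkDist E s t ≤ walkLength W :=
  Nat.sInf_le ⟨W, h, rfl⟩

section Swap

variable {V ι : Type*} [LinearOrder V] {E : V → V → Prop} {s t : ι → V}

open Finset in
/-- Two shortest paths through `u ≤ w` may exchange their segments between `u` and `w`. -/
lemma exists_swap_segment (hE : ∀ a b, E a b → a < b) (C : Finset ι) (P : ι → List V)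
    (hP : ∀ i ∈ C, IsShortestPath E (s i) (t i) (P i)) {i j : ι} (hi : i ∈ C) (hj : j ∈ C)
    {u w : V} (huw : u ≤ w) (hui : u ∈ P i) (hwi : w ∈ P i) (huj : u ∈ P j) (hwj : w ∈ P j) :
    ∃ P' : ι → List V, (∀ i ∈ C, IsShortestPath E (s i) (t i) (P' i)) ∧
      (∀ x, #{l ∈ C | x ∈ P' l} = #{l ∈ C | x ∈ P l}) ∧
      ∀ x, x ∈ P' i ↔ if u ≤ x ∧ x < w then x ∈ P j else x ∈ P i := by
  classical
  rcases eq_or_ne i j with rfl | hij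
  · exact ⟨P, hP, fun _ => rfl, by simp⟩
  set A := splice (P i) (P j) u with hA
  set B := splice (P j) (P i) u with hB
  have wi := (hP i hi).1.1
  have wj := (hP j hj).1.1
  have wA : IsWalk E (s i) (t j) A := wi.splice hE wj hui huj
  have wB : IsWalk E (s j) (t i) B := wj.splice hE wi huj hui
  have hwA : w ∈ A := by simp [hA, mem_splice, huw.not_gt, hwj]
  have hwB : w ∈ B := by simp [hB, mem_splice, huw.not_gt, hwi]
  have wi' := wA.splice hE wB hwA hwB
  have wj' := wB.splice hE wA hwB hwA
  have hlen := length_splice_add A B w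
  have hlen' : A.length + B.length = _ := length_splice_add (P i) (P j) u
  have di := walkDist_le wi'
  have dj := walkDist_le wj'
  have ei := (hP i hi).2
  have ej := (hP j hj).2
  have pi := List.length_pos_iff.2 wi.1
  have pj := List.length_pos_iff.2 wj.1
  have pi' := List.length_pos_iff.2 wi'.1
  have pj' := List.length_pos_iff.2 wj'.1
  simp only [walkLength] at di dj ei ej
  let P' := Function.update (Function.update P i (splice A B w)) j (splice B A w)
  have hP'i : P' i = splice A B w := by simp [P', hij]
  have hP'j : P' j = splice B A w := by simp [P']
  have hP'l (l : ι) (h1 : l ≠ i) (h2 : l ≠ j) : P' l = P l := by simp [P', h1, h2]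
  refine ⟨P', fun l hl => ?_, fun x => ?_, fun x => ?_⟩
  · rcases eq_or_ne l j with rfl | h2
    · rw [hP'j]
      exact ⟨⟨wj', (wj'.pairwise hE).imp ne_of_lt⟩, by simp only [walkLength]; omega⟩
    rcases eq_or_ne l i with rfl | h1
    · rw [hP'i]
      exact ⟨⟨wi', (wi'.pairwise hE).imp ne_of_lt⟩, by simp only [walkLength]; omega⟩
    rw [hP'l l h1 h2]
    exact hP l hl
  · by_cases hx : u ≤ x ∧ x < w
    · refine Finset.card_equiv (Equiv.swap i j) fun l => ?_
      rcases eq_or_ne l j with rfl | h2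
      · simp [hP'j, mem_splice, hA, hB, hx, hx.1.not_gt, hi, hj]
      rcases eq_or_ne l i with rfl | h1
      · simp [hP'i, mem_splice, hA, hB, hx, hx.1.not_gt, hi, hj]
      simp [Equiv.swap_apply_of_ne_of_ne h1 h2, hP'l l h1 h2]
    · congr 1
      refine Finset.filter_congr fun l _ => ?_
      have hx' : x < u ∧ x < w ∨ ¬ x < u ∧ ¬ x < w := by
        rcases lt_or_ge x u with h | h
        · exact .inl ⟨h, h.trans_le huw⟩
        · exact .inr ⟨h.not_gt, fun h' => hx ⟨h, h'⟩⟩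
      rcases eq_or_ne l j with rfl | h2
      · rcases hx' with h | h <;> simp [hP'j, mem_splice, hA, hB, h]
      rcases eq_or_ne l i with rfl | h1
      · rcases hx' with h | h <;> simp [hP'i, mem_splice, hA, hB, h]
      rw [hP'l l h1 h2]
  · rw [hP'i]
    rcases lt_or_ge x u with h | h
    · simp [mem_splice, hA, h, h.trans_le huw, h.not_ge]
    · by_cases h' : x < w <;> simp [mem_splice, hA, hB, h, h', h.not_gt]

open Finset in
/-- Segments can be exchanged so that a single path visits all the given vertices of high
congestion. -/
lemma exists_path_through (hE : ∀ a b, E a b → a < b) (C : Finset ι) (d : ℕ) (hC : 3 * d < #C)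
    (P : ι → List V) (hP : ∀ i ∈ C, IsShortestPath E (s i) (t i) (P i))
    {b : V} (hb : #C ≤ #{l ∈ C | b ∈ P l} + d) (T : Finset V)
    (hT : ∀ x ∈ T, #C ≤ #{l ∈ C | x ∈ P l} + d) (hTb : ∀ x ∈ T, x ≤ b) :
    ∃ P' : ι → List V, (∀ i ∈ C, IsShortestPath E (s i) (t i) (P' i)) ∧
      (∀ x, #{l ∈ C | x ∈ P' l} = #{l ∈ C | x ∈ P l}) ∧
      ∃ i ∈ C, b ∈ P' i ∧ ∀ x ∈ T, x ∈ P' i := by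
  induction T using Finset.induction_on_max with
  | empty =>
    obtain ⟨i, hi, hbi, -⟩ := exists_mem_three P C d hC hb hb hb
    exact ⟨P, hP, fun _ => rfl, i, hi, hbi, by simp⟩
  | insert a T ha ih =>
    obtain ⟨P₁, hP₁, hcong, i, hi, hbi, hTi⟩ :=
      ih (fun x hx => hT x (mem_insert_of_mem hx)) (fun x hx => hTb x (mem_insert_of_mem hx))
    have hab : a ≤ b := hTb a (mem_insert_self a T)
    have haC := hT a (mem_insert_self a T)
    rcases T.eq_empty_or_nonempty with rfl | hne
    · obtain ⟨j, hj, haj, hbj, -⟩ := exists_mem_three P C d hC haC hb hb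
      exact ⟨P, hP, fun _ => rfl, j, hj, hbj, by simpa using haj⟩
    set u := T.max' hne with hu
    have huT : u ∈ T := T.max'_mem hne
    have hua : u < a := ha u huT
    obtain ⟨j, hj, huj, haj, hbj⟩ := exists_mem_three P₁ C d hC
      (by rw [hcong]; exact hT u (mem_insert_of_mem huT)) (by rwa [hcong a])
      (by rwa [hcong b])
    obtain ⟨P₂, hP₂, hcong₂, hmem⟩ := exists_swap_segment hE C P₁ hP₁ hi hj
      (hua.le.trans hab) (hTi u huT) hbi huj hbj
    refine ⟨P₂, hP₂, fun x => (hcong₂ x).trans (hcong x), i, hi, ?_, fun x hx => ?_⟩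
    · simp [hmem, hbi]
    · rw [hmem]
      split_ifs with hx'
      · rcases mem_insert.1 hx with rfl | hx
        · exact haj
        · rwa [le_antisymm (T.le_max' x hx) hx'.1]
      · rcases mem_insert.1 hx with rfl | hx
        · rwa [le_antisymm hab (not_lt.1 fun h => hx' ⟨hua.le, h⟩)]
        · exact hTi x hx

open Finset in
lemma exists_erase [Fintype V] (hE : ∀ a b, E a b → a < b) (C : Finset ι) (d : ℕ)
    (hC : 3 * d < #C) (P : ι → List V) (hP : ∀ i ∈ C, IsShortestPath E (s i) (t i) (P i))
    (hcong : ∀ x, #{l ∈ C | x ∈ P l} + d ≤ #C) :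
    ∃ C' : Finset ι, #C' + 1 = #C ∧ ∃ P' : ι → List V,
      (∀ i ∈ C', IsShortestPath E (s i) (t i) (P' i)) ∧
      ∀ x, #{l ∈ C' | x ∈ P' l} + d ≤ #C' := by
  classical
  obtain ⟨P', hP', hcong', i, hi, hmem⟩ : ∃ P' : ι → List V,
      (∀ i ∈ C, IsShortestPath E (s i) (t i) (P' i)) ∧
      (∀ x, #{l ∈ C | x ∈ P' l} = #{l ∈ C | x ∈ P l}) ∧
      ∃ i ∈ C, ∀ x, #C ≤ #{l ∈ C | x ∈ P l} + d → x ∈ P' i := by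
    set S : Finset V := {x | #C ≤ #{l ∈ C | x ∈ P l} + d} with hS
    rcases S.eq_empty_or_nonempty with h | h
    · obtain ⟨i, hi⟩ := card_pos.1 (by omega : 0 < #C)
      refine ⟨P, hP, fun _ => rfl, i, hi, fun x hx => ?_⟩
      have : x ∈ S := by simpa [hS] using hx
      simp [h] at this
    · have hmax := S.max'_mem h
      obtain ⟨P', hP', hc, i, hi, -, hi'⟩ := exists_path_through hE C d hC P hP
        (b := S.max' h) (by simpa only [hS, mem_filter_univ] using hmax) S
        (fun x hx => by simpa only [hS, mem_filter_univ] using hx) (fun x hx => S.le_max' x hx)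
      exact ⟨P', hP', hc, i, hi, fun x hx => hi' x (by simpa [hS] using hx)⟩
  have hcard := card_erase_add_one hi
  refine ⟨C.erase i, hcard, P', fun l hl => hP' l (mem_of_mem_erase hl), fun x => ?_⟩
  have h1 := hcong x
  have h2 := hcong' x
  by_cases hx : x ∈ P' i
  · have h3 := card_erase_add_one (s := {l ∈ C | x ∈ P' l}) (a := i) (by simp [hi, hx])
    rw [← filter_erase] at h3
    omega
  · have h3 := card_le_card (filter_subset_filter (fun l => x ∈ P' l) (erase_subset i C))
    have h4 : ¬ #C ≤ #{l ∈ C | x ∈ P l} + d := fun h => hx (hmem x h)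
    omega

open Finset in
lemma exists_core [Fintype V] (hE : ∀ a b, E a b → a < b) (d n : ℕ) (C : Finset ι)
    (hC : #C = 3 * d + n) (P : ι → List V) (hP : ∀ i ∈ C, IsShortestPath E (s i) (t i) (P i))
    (hcong : ∀ x, #{l ∈ C | x ∈ P l} + d ≤ #C) :
    ∃ C' : Finset ι, #C' = 3 * d ∧ ∃ P' : ι → List V,
      (∀ i ∈ C', IsShortestPath E (s i) (t i) (P' i)) ∧
      ∀ x, #{l ∈ C' | x ∈ P' l} + d ≤ #C' := by
  induction n generalizing C P with
  | zero => exact ⟨C, hC, P, hP, hcong⟩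
  | succ n ih =>
    obtain ⟨C', hC', P', hP', hc'⟩ := exists_erase hE C d (by omega) P hP hcong
    exact ih C' (by omega) P' hP' hc'

end Swap

lemma IsAcyclic.exists_linearOrder {V : Type*} {E : V → V → Prop} (h : IsAcyclic E) :
    ∃ _ : LinearOrder V, ∀ a b, E a b → a < b := by
  classical
  have hcyc (a b : V) (hab : Relation.ReflTransGen E a b) (hba : E b a) : False := by
    obtain ⟨l, hl, hlast⟩ := List.exists_isChain_cons_of_relationReflTransGen hab
    have := h b (b :: a :: l) ⟨by simp, by simp, by
      rw [List.getLast?_cons_cons, List.getLast?_eq_getLast_of_ne_nil (by simp), hlast],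
      List.isChain_cons_cons.2 ⟨hba, hl⟩⟩
    simp [walkLength] at this
  let po : PartialOrder V :=
    { le := Relation.ReflTransGen E
      le_refl := fun _ => .refl
      le_trans := fun _ _ _ => .trans
      le_antisymm := fun a b hab hba => by
        rcases hba.cases_tail with h' | ⟨c, hbc, hca⟩
        · exact h'
        · exact (hcyc a c (hab.trans hbc) hca).elim }
  let lo : LinearOrder (LinearExtension V) := inferInstance
  refine ⟨lo, fun a b hab => ?_⟩
  refine lt_of_le_of_ne (toLinearExtension.monotone (a := a) (b := b) (.single hab)) ?_
  rintro rfl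
  exact hcyc a a .refl hab

lemma IsAcyclic.exists_isShortestPath {V : Type*} {E : V → V → Prop} (h : IsAcyclic E) {s t : V}
    (hw : ∃ W, IsWalk E s t W) : ∃ W, IsShortestPath E s t W := by
  obtain ⟨_, hE⟩ := h.exists_linearOrder
  obtain ⟨W, hW⟩ := hw
  obtain ⟨W', hW', hlen⟩ := Nat.sInf_mem (s := {n | ∃ W, IsWalk E s t W ∧ walkLength W = n})
    ⟨_, W, hW, rfl⟩
  exact ⟨W', ⟨hW', (hW'.pairwise hE).imp ne_of_lt⟩, hlen⟩

open Finset in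
lemma congestion_eq_card_filter {V ι : Type*} [Fintype ι] [DecidableEq V] (P : ι → List V)
    (v : V) : congestion P v = #{i | v ∈ P i} := by
  rw [congestion, Nat.card_eq_fintype_card, Fintype.card_subtype]

open Finset in
lemma congestion_subtype_eq {V ι : Type*} [DecidableEq V] (C : Finset ι)
    (P : ι → List V) (v : V) :
    congestion (fun i : {i // i ∈ C} => P i) v = #{i ∈ C | v ∈ P i} := by
  classical
  rw [congestion_eq_card_filter, ← Finset.card_map (Function.Embedding.subtype _)]
  congr 1
  ext i
  simp [and_comm]

/-- Lemma 1 (reduction lemma) of the paper: solvability of `(k,c)`-Disjoint Shortest Paths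
on a finite DAG is equivalent to reachability of all pairs plus solvability of a
`(3d, 2d)`-sub-instance, where `d = k - c` and `k > 3d`. -/
theorem reduction_to_small_core {V : Type*} [Fintype V] (E : V → V → Prop)
    (hacyc : IsAcyclic E) (k c d : ℕ) (hck : c ≤ k) (hd : d = k - c) (hk : k > 3 * d)
    (s t : Fin k → V) :
    (∃ P : Fin k → List V,
        (∀ i, IsShortestPath E (s i) (t i) (P i)) ∧ ∀ v, congestion P v ≤ c) ↔
      ((∀ i, ∃ W, IsWalk E (s i) (t i) W) ∧
        ∃ C : Finset (Fin k), C.card = 3 * d ∧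
          ∃ Q : {i : Fin k // i ∈ C} → List V,
            (∀ i : {i : Fin k // i ∈ C}, IsShortestPath E (s i.1) (t i.1) (Q i)) ∧
              ∀ v, congestion Q v ≤ 2 * d) := by
  classical
  constructor
  · rintro ⟨P, hP, hcong⟩
    refine ⟨fun i => ⟨P i, (hP i).1.1⟩, ?_⟩
    obtain ⟨_, hE⟩ := hacyc.exists_linearOrder
    obtain ⟨C, hC, Q, hQ, hc⟩ := exists_core hE d (k - 3 * d) Finset.univ
      (by rw [Finset.card_univ, Fintype.card_fin]; omega) P (fun i _ => hP i) (fun x => by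
        have := hcong x
        rw [congestion_eq_card_filter] at this
        rw [Finset.card_univ, Fintype.card_fin]
        omega)
    refine ⟨C, hC, fun i => Q i, fun i => hQ i i.2, fun v => ?_⟩
    have := hc v
    rw [congestion_subtype_eq]
    omega
  · rintro ⟨hw, C, hC, Q, hQ, hcong⟩
    choose R hR using fun i => hacyc.exists_isShortestPath (hw i)
    let P (i : Fin k) : List V := if h : i ∈ C then Q ⟨i, h⟩ else R i
    have hPQ : (fun i : {i // i ∈ C} => P i) = Q := by
      ext1 i
      simp [P]
    refine ⟨P, fun i => ?_, fun v => ?_⟩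
    · by_cases h : i ∈ C
      · simpa [P, h] using hQ ⟨i, h⟩
      · simpa [P, h] using hR i
    · have h1 := hcong v
      rw [← hPQ, congestion_subtype_eq] at h1
      have hsub : (Finset.univ.filter fun i => v ∈ P i) ⊆ C.filter (fun i => v ∈ P i) ∪ Cᶜ := by
        intro i hi
        simp only [Finset.mem_union, Finset.mem_filter, Finset.mem_compl] at hi ⊢
        tauto
      have h2 := (Finset.card_le_card hsub).trans (Finset.card_union_le _ _)
      rw [Finset.card_compl, Fintype.card_fin] at h2
      rw [congestion_eq_card_filter]
      omega
end

section
/- Let (V,E) be a finite DAG. Let P be a path from s to t and let Q be a path from s' to t'. Suppose u and v are vertices lying on both P and Q, with u occurring strictly before v on P and u occurring strictly before v on Q. Let P' be the walk obtained by concatenating the segment of P from s to u, the segment of Q from u to v, and the segment of P from v to t; let Q' be the walk obtained by concatenating the segment of Q from s' to u, the segment of P from u to v, and the segment of Q from v to t'. Then: (i) P' and Q' are paths, i.e., their vertices are pairwise distinct; (ii) length(P') + length(Q') = length(P) + length(Q); (iii) every vertex of V has the same congestion with respect to the pair (P',Q') as with respect to the pair (P,Q); and (iv) if P is a shortest path from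 s to t and Q is a shortest path from s' to t', then P' is a shortest path from s to t and Q' is a shortest path from s' to t'. -/
/-- In an acyclic digraph, every chain has pairwise distinct vertices. -/
theorem IsAcyclic.nodup_of_isChain {V : Type*} {E : V → V → Prop} (hE : IsAcyclic E)
    {W : List V} (hW : W.IsChain E) : W.Nodup := by
  induction W with
  | nil => exact List.nodup_nil
  | cons a l ih =>
    refine List.nodup_cons.2 ⟨fun ha => ?_, ih hW.tail⟩
    obtain ⟨x, y, rfl⟩ := List.append_of_mem ha
    have hchain : (a :: (x ++ [a])).IsChain E := hW.prefix ⟨y, by simp⟩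
    have h := hE a (a :: (x ++ [a])) ⟨by simp, by simp, by simp [List.getLast?_cons], hchain⟩
    simp [walkLength] at h

/-- Replacing the segment of a walk between `u` and `v` by that of another walk gives a walk. -/
theorem IsWalk.replace_segment {V : Type*} {E : V → V → Prop} {s t s' t' u v : V}
    {Pa Pb Pc Qa Qb Qc : List V} (hP : IsWalk E s t (Pa ++ u :: (Pb ++ v :: Pc)))
    (hQ : IsWalk E s' t' (Qa ++ u :: (Qb ++ v :: Qc))) :
    IsWalk E s t (Pa ++ u :: (Qb ++ v :: Pc)) := by
  obtain ⟨-, hs, ht, hPc⟩ := hP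
  obtain ⟨-, -, -, hQc⟩ := hQ
  change List.IsChain E _ at hPc hQc
  refine ⟨by simp, ?_, ?_, ?_⟩
  · cases Pa <;> simpa using hs
  · simpa [List.getLast?_append, List.getLast?_cons] using ht
  · change List.IsChain E _
    obtain ⟨hPa, hPbc⟩ := List.isChain_split.1 hPc
    have hPvc := (List.isChain_split (l₁ := u :: Pb).1 hPbc).2
    have hQub := (List.isChain_split (l₁ := u :: Qb).1 (List.isChain_split.1 hQc).2).1
    exact List.isChain_split.2 ⟨hPa, List.isChain_split (l₁ := u :: Qb).2 ⟨hQub, hPvc⟩⟩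

theorem walkDist_le_walkLength {V : Type*} {E : V → V → Prop} {s t : V} {W : List V}
    (hW : IsWalk E s t W) : walkDist E s t ≤ walkLength W :=
  Nat.sInf_le ⟨W, hW, rfl⟩

open Classical in
/-- For lists without repetitions, congestion is the total number of occurrences. -/
theorem congestion_eq_sum_count {V ι : Type*} [Fintype ι] {P : ι → List V}
    (hP : ∀ i, (P i).Nodup) (w : V) : congestion P w = ∑ i, (P i).count w := by
  simp only [congestion, Nat.card_eq_fintype_card, Fintype.card_subtype, Finset.card_filter,
    fun i => (hP i).count (a := w)]

/-- The swapping operation of the paper: given paths `P` (from `s` to `t`) and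
`Q` (from `s'` to `t'`) in a finite DAG, both passing through `u` strictly before `v`,
swapping the middle segments yields paths again, preserves total length, preserves
all congestions, and preserves the shortest-path property. -/
theorem swap_segments {V : Type*} [Fintype V] (E : V → V → Prop) (hacyc : IsAcyclic E)
    (s t s' t' u v : V) (Pa Pb Pc Qa Qb Qc : List V)
    (hP : IsPath E s t (Pa ++ u :: (Pb ++ v :: Pc)))
    (hQ : IsPath E s' t' (Qa ++ u :: (Qb ++ v :: Qc))) :
    IsPath E s t (Pa ++ u :: (Qb ++ v :: Pc)) ∧
    IsPath E s' t' (Qa ++ u :: (Pb ++ v :: Qc)) ∧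
    walkLength (Pa ++ u :: (Qb ++ v :: Pc)) + walkLength (Qa ++ u :: (Pb ++ v :: Qc)) =
      walkLength (Pa ++ u :: (Pb ++ v :: Pc)) + walkLength (Qa ++ u :: (Qb ++ v :: Qc)) ∧
    (∀ w : V,
      congestion ![Pa ++ u :: (Qb ++ v :: Pc), Qa ++ u :: (Pb ++ v :: Qc)] w =
        congestion ![Pa ++ u :: (Pb ++ v :: Pc), Qa ++ u :: (Qb ++ v :: Qc)] w) ∧
    (IsShortestPath E s t (Pa ++ u :: (Pb ++ v :: Pc)) →
      IsShortestPath E s' t' (Qa ++ u :: (Qb ++ v :: Qc)) →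
      IsShortestPath E s t (Pa ++ u :: (Qb ++ v :: Pc)) ∧
        IsShortestPath E s' t' (Qa ++ u :: (Pb ++ v :: Qc))) := by
  have hP' := hP.1.replace_segment hQ.1
  have hQ' := hQ.1.replace_segment hP.1
  have nP' := hacyc.nodup_of_isChain hP'.2.2.2
  have nQ' := hacyc.nodup_of_isChain hQ'.2.2.2
  have hlen : walkLength (Pa ++ u :: (Qb ++ v :: Pc)) + walkLength (Qa ++ u :: (Pb ++ v :: Qc)) =
      walkLength (Pa ++ u :: (Pb ++ v :: Pc)) + walkLength (Qa ++ u :: (Qb ++ v :: Qc)) := by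
    simp only [walkLength, List.length_append, List.length_cons]
    omega
  refine ⟨⟨hP', nP'⟩, ⟨hQ', nQ'⟩, hlen, fun w => ?_, fun h h' => ?_⟩
  · classical
    rw [congestion_eq_sum_count (Fin.forall_fin_two.2 ⟨nP', nQ'⟩),
      congestion_eq_sum_count (Fin.forall_fin_two.2 ⟨hP.2, hQ.2⟩)]
    simp only [Fin.sum_univ_two, Matrix.cons_val_zero, Matrix.cons_val_one, List.count_append,
      List.count_cons]
    omega
  · have d := walkDist_le_walkLength hP'
    have d' := walkDist_le_walkLength hQ'
    have e := h.2
    have e' := h'.2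
    exact ⟨⟨⟨hP', nP'⟩, by omega⟩, ⟨⟨hQ', nQ'⟩, by omega⟩⟩
end

section
/- Let (V,E) be a finite digraph, let c ≥ 1 and let (s_i, t_i), i ∈ {1,…,k}, be terminal pairs such that the 2k terminal vertices are pairwise distinct, every s_i has no incoming edge, and every t_i has no outgoing edge. Let G' be the c-fold blow-up of G at the non-terminal vertices as defined from T ⊕ (N × Fin c). Then: (a) for all terminals x, y of G, there is a walk from x to y in G' if and only if there is a walk from x to y in G, and in that case dist_{G'}(x,y) = dist_G(x,y); and (b) for all non-terminal vertices u, v of G and every ℓ ∈ Fin c, there is a walk from (u,ℓ) to (v,ℓ) in G' if and only if there is a walk from u to v in G, and in that case dist_{G'}((u,ℓ),(v,ℓ)) = dist_G(u,v). -/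
/-- A vertex is a terminal if it is one of the sources or one of the sinks. -/
def Terminal {V : Type*} {k : ℕ} (s t : Fin k → V) (v : V) : Prop :=
  (∃ i, s i = v) ∨ (∃ i, t i = v)

/-- The vertex set of the `c`-fold blow-up of a digraph at its non-terminal vertices:
terminals, plus `c` copies of every non-terminal vertex. -/
abbrev BlowupV {V : Type*} {k : ℕ} (s t : Fin k → V) (c : ℕ) : Type _ :=
  {v : V // Terminal s t v} ⊕ ({v : V // ¬ Terminal s t v} × Fin c)

/-- The edge relation of the `c`-fold blow-up of a digraph at its non-terminal
vertices. -/
def BlowupE {V : Type*} {k : ℕ} (E : V → V → Prop) (s t : Fin k → V) (c : ℕ) :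
    BlowupV s t c → BlowupV s t c → Prop
  | Sum.inl a, Sum.inl b => E a.1 b.1
  | Sum.inl a, Sum.inr b => E a.1 b.1.1
  | Sum.inr a, Sum.inl b => E a.1.1 b.1
  | Sum.inr a, Sum.inr b => a.2 = b.2 ∧ E a.1.1 b.1.1

/-- The image of a walk under an edge-preserving map is a walk. -/
theorem IsWalk.map {V V' : Type*} {E : V → V → Prop} {E' : V' → V' → Prop} {f : V → V'}
    (hf : ∀ a b, E a b → E' (f a) (f b)) {x y : V} {W : List V} (h : IsWalk E x y W) :
    IsWalk E' (f x) (f y) (W.map f) := by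
  obtain ⟨hne, hhead, hlast, hchain⟩ := h
  exact ⟨by simpa using hne, by simp [hhead], by simp [hlast],
    List.isChain_map_of_isChain f hf hchain⟩

/-- Edge-preserving maps in both directions which exchange the endpoints preserve the
existence of walks and the distance. -/
theorem exists_isWalk_iff_and_walkDist_eq {V V' : Type*} {E : V → V → Prop}
    {E' : V' → V' → Prop} {f : V → V'} {g : V' → V}
    (hf : ∀ a b, E a b → E' (f a) (f b)) (hg : ∀ a b, E' a b → E (g a) (g b))
    {x y : V} {x' y' : V'} (hfx : f x = x') (hfy : f y = y') (hgx : g x' = x)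
    (hgy : g y' = y) :
    ((∃ W, IsWalk E' x' y' W) ↔ ∃ W, IsWalk E x y W) ∧
      walkDist E' x' y' = walkDist E x y := by
  have push (W : List V) (h : IsWalk E x y W) : IsWalk E' x' y' (W.map f) :=
    hfx ▸ hfy ▸ h.map hf
  have pull (W : List V') (h : IsWalk E' x' y' W) : IsWalk E x y (W.map g) := by
    simpa only [hgx, hgy] using h.map hg
  refine ⟨⟨fun ⟨W, h⟩ => ⟨_, pull W h⟩, fun ⟨W, h⟩ => ⟨_, push W h⟩⟩, ?_⟩
  unfold walkDist
  congr 1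
  ext n
  exact ⟨fun ⟨W, h, hn⟩ => ⟨_, pull W h, by simpa [walkLength] using hn⟩,
    fun ⟨W, h, hn⟩ => ⟨_, push W h, by simpa [walkLength] using hn⟩⟩

section Blowup

variable {V : Type*} {k : ℕ} {s t : Fin k → V} {c : ℕ}

/-- The projection of the blow-up onto the original vertex set. -/
def blowupProj : BlowupV s t c → V
  | Sum.inl a => a.1
  | Sum.inr a => a.1.1

open Classical in
/-- The embedding of the original vertex set as the `ℓ`-th layer of the blow-up. -/
noncomputable def blowupLayer (s t : Fin k → V) (ℓ : Fin c) (v : V) : BlowupV s t c :=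
  if h : Terminal s t v then Sum.inl ⟨v, h⟩ else Sum.inr (⟨v, h⟩, ℓ)

theorem blowupE_blowupLayer {E : V → V → Prop} (ℓ : Fin c) (a b : V) (h : E a b) :
    BlowupE E s t c (blowupLayer s t ℓ a) (blowupLayer s t ℓ b) := by
  unfold blowupLayer
  split_ifs <;> simpa [BlowupE] using h

theorem edge_blowupProj {E : V → V → Prop} :
    ∀ a b : BlowupV s t c, BlowupE E s t c a b → E (blowupProj a) (blowupProj b)
  | Sum.inl _, Sum.inl _, h => h
  | Sum.inl _, Sum.inr _, h => h
  | Sum.inr _, Sum.inl _, h => h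
  | Sum.inr _, Sum.inr _, h => h.2

end Blowup

/-- Walks and distances between corresponding vertices are preserved by the `c`-fold
blow-up at the non-terminal vertices: (a) between terminals, and (b) between the
`ℓ`-th copies of non-terminal vertices. -/
theorem blowup_preserves_walks_and_dist {V : Type*} [Fintype V] {k : ℕ}
    (E : V → V → Prop) (c : ℕ) (hc : 1 ≤ c) (s t : Fin k → V)
    (hinj : Function.Injective (Sum.elim s t : Fin k ⊕ Fin k → V))
    (hs : ∀ i v, ¬ E v (s i)) (ht : ∀ i v, ¬ E (t i) v) :
    (∀ (x y : V) (hx : Terminal s t x) (hy : Terminal s t y),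
      ((∃ W, IsWalk (BlowupE E s t c) (Sum.inl ⟨x, hx⟩) (Sum.inl ⟨y, hy⟩) W) ↔
        ∃ W, IsWalk E x y W) ∧
      ((∃ W, IsWalk E x y W) →
        walkDist (BlowupE E s t c) (Sum.inl ⟨x, hx⟩) (Sum.inl ⟨y, hy⟩) =
          walkDist E x y)) ∧
    (∀ (u v : V) (hu : ¬ Terminal s t u) (hv : ¬ Terminal s t v) (ℓ : Fin c),
      ((∃ W, IsWalk (BlowupE E s t c)
          (Sum.inr (⟨u, hu⟩, ℓ)) (Sum.inr (⟨v, hv⟩, ℓ)) W) ↔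
        ∃ W, IsWalk E u v W) ∧
      ((∃ W, IsWalk E u v W) →
        walkDist (BlowupE E s t c) (Sum.inr (⟨u, hu⟩, ℓ)) (Sum.inr (⟨v, hv⟩, ℓ)) =
          walkDist E u v)) := by
  refine ⟨fun x y hx hy => ?_, fun u v hu hv ℓ => ?_⟩
  · have h := exists_isWalk_iff_and_walkDist_eq (blowupE_blowupLayer (E := E) ⟨0, hc⟩)
      edge_blowupProj (dif_pos hx) (dif_pos hy) rfl rfl
    exact ⟨h.1, fun _ => h.2⟩
  · have h := exists_isWalk_iff_and_walkDist_eq (blowupE_blowupLayer (E := E) ℓ)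
      edge_blowupProj (dif_neg hu) (dif_neg hv) rfl rfl
    exact ⟨h.1, fun _ => h.2⟩
end

section
/- Let E be an edge relation on a type V and let V₁ ⊆ V be a set of vertices such that there is no edge from outside V₁ into V₁ (i.e., for all u ∉ V₁ and v ∈ V₁, ¬ E u v). Then every walk from a vertex s ∈ V₁ to a vertex t ∉ V₁ contains exactly one consecutive pair of vertices (x,y) with x ∈ V₁ and y ∉ V₁; moreover, all vertices of the walk up to and including x lie in V₁ and all vertices from y onwards lie outside V₁. -/
/-- Along a chain, once the vertices leave a set that no edge enters, they stay outside. -/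
theorem getD_notMem_of_le {V : Type*} {E : V → V → Prop} {V₁ : Set V}
    (hcl : ∀ u ∉ V₁, ∀ v ∈ V₁, ¬ E u v) {W : List V} (hW : W.IsChain E) (d : V)
    {i j : ℕ} (hij : i ≤ j) (hj : j < W.length) (hi : W.getD i d ∉ V₁) :
    W.getD j d ∉ V₁ := by
  induction j, hij using Nat.le_induction with
  | base => exact hi
  | succ k _ ih =>
    intro hmem
    have hk : k < W.length := by lia
    refine hcl _ (ih hk) _ hmem ?_
    rw [List.getD_eq_getElem _ _ hk, List.getD_eq_getElem _ _ hj]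
    exact List.isChain_iff_getElem.mp hW k hj

/-- If there is no edge from outside `V₁` into `V₁`, then every walk from `s ∈ V₁` to
`t ∉ V₁` contains exactly one consecutive pair `(x, y)` with `x ∈ V₁` and `y ∉ V₁`;
moreover, all vertices up to and including `x` lie in `V₁` and all vertices from `y`
onwards lie outside `V₁`. -/
theorem unique_boundary_crossing {V : Type*} (E : V → V → Prop) (V₁ : Set V)
    (hcl : ∀ u ∉ V₁, ∀ v ∈ V₁, ¬ E u v)
    (s t : V) (hs : s ∈ V₁) (ht : t ∉ V₁)
    (W : List V) (hW : IsWalk E s t W) :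
    (∃! n : ℕ, n + 1 < W.length ∧ W.getD n s ∈ V₁ ∧ W.getD (n + 1) s ∉ V₁) ∧
    (∀ n : ℕ, (n + 1 < W.length ∧ W.getD n s ∈ V₁ ∧ W.getD (n + 1) s ∉ V₁) →
      ∀ m : ℕ, m < W.length →
        (m ≤ n → W.getD m s ∈ V₁) ∧ (n < m → W.getD m s ∉ V₁)) := by
  obtain ⟨hne, hhead, hlast, hchain⟩ := hW
  have hpos : 0 < W.length := List.length_pos_iff.mpr hne
  have hstay {i j : ℕ} (hij : i ≤ j) (hj : j < W.length) (hi : W.getD i s ∉ V₁) :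
      W.getD j s ∉ V₁ := getD_notMem_of_le hcl hchain s hij hj hi
  have hfirst : W.getD 0 s ∈ V₁ := by
    rw [List.getD_eq_getElem?_getD, ← List.head?_eq_getElem?, hhead]
    exact hs
  have hend : W.getD (W.length - 1) s ∉ V₁ := by
    rw [List.getD_eq_getElem?_getD, ← List.getLast?_eq_getElem?, hlast]
    exact ht
  have hsides : ∀ n : ℕ, (n + 1 < W.length ∧ W.getD n s ∈ V₁ ∧ W.getD (n + 1) s ∉ V₁) →
      ∀ m : ℕ, m < W.length →
        (m ≤ n → W.getD m s ∈ V₁) ∧ (n < m → W.getD m s ∉ V₁) := by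
    rintro n ⟨hn, hin, hout⟩ m hm
    refine ⟨fun hmn => ?_, fun hnm => hstay hnm hm hout⟩
    by_contra hmem
    exact hstay hmn (by lia) hmem hin
  refine ⟨?_, hsides⟩
  classical
  have hex : ∃ n, W.getD n s ∉ V₁ := ⟨_, hend⟩
  obtain ⟨n, hn⟩ : ∃ n, Nat.find hex = n + 1 :=
    Nat.exists_eq_succ_of_ne_zero fun h => (h ▸ Nat.find_spec hex) hfirst
  have hle : Nat.find hex ≤ W.length - 1 := Nat.find_min' hex hend
  have hcross : n + 1 < W.length ∧ W.getD n s ∈ V₁ ∧ W.getD (n + 1) s ∉ V₁ :=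
    ⟨by lia, not_not.mp (Nat.find_min hex (by lia)), hn ▸ Nat.find_spec hex⟩
  refine ⟨n, hcross, fun k hk => le_antisymm ?_ ?_⟩
  · by_contra! h
    exact (hsides n hcross k (by lia)).2 h hk.2.1
  · by_contra! h
    exact (hsides k hk n (by lia)).2 h hcross.2.1
end
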